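/- arXiv:1608.00913 — 9 statements merged into one kernel-verified Lean document; each statement's English description precedes it below -/
import Mathlib

section
/- Fix natural numbers s ≤ t and θ ≥ 0. Let X_τ and Y_τ, for τ = s, s+1, …, t, be real-valued random variables on a common probability space such that for each τ the pair X_τ, Y_τ is independent. Then E[exp(−θ · min_{s ≤ τ ≤ t}(X_τ + Y_τ))] ≤ ∑_{τ=s}^{t} E[exp(−θ X_τ)] · E[exp(−θ Y_τ)], provided all expectations on the right-hand side are finite. -/
open MeasureTheory ProbabilityTheory

/-- MGF bound for the (min,+) convolution of two servers (inequality (8) of the paper):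
`E[exp(-θ min_{s≤τ≤t}(X_τ + Y_τ))] ≤ ∑_{τ=s}^{t} E[exp(-θ X_τ)] E[exp(-θ Y_τ)]`,
assuming per-`τ` independence of `X_τ` and `Y_τ` and finiteness of the right-hand side
expectations. -/
theorem stmt_2 {Ω : Type*} [MeasurableSpace Ω] (μ : Measure Ω) [IsProbabilityMeasure μ]
    (s t : ℕ) (hst : s ≤ t) (θ : ℝ) (hθ : 0 ≤ θ)
    (X Y : ℕ → Ω → ℝ)
    (hXm : ∀ τ, Measurable (X τ)) (hYm : ∀ τ, Measurable (Y τ))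
    (hindep : ∀ τ, IndepFun (X τ) (Y τ) μ)
    (hXi : ∀ τ, Integrable (fun ω => Real.exp (-θ * X τ ω)) μ)
    (hYi : ∀ τ, Integrable (fun ω => Real.exp (-θ * Y τ ω)) μ) :
    (∫ ω, Real.exp (-θ * (Finset.Icc s t).inf' (Finset.nonempty_Icc.mpr hst)
          (fun τ => X τ ω + Y τ ω)) ∂μ)
      ≤ ∑ τ ∈ Finset.Icc s t,
          (∫ ω, Real.exp (-θ * X τ ω) ∂μ) * (∫ ω, Real.exp (-θ * Y τ ω) ∂μ) := by
  have hind : ∀ τ, IndepFun (fun ω => Real.exp (-θ * X τ ω)) (fun ω => Real.exp (-θ * Y τ ω)) μ := by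
    intro τ
    have hm : Measurable (fun x : ℝ => Real.exp (-θ * x)) := by fun_prop
    exact (hindep τ).comp hm hm
  have hint : ∀ τ, Integrable (fun ω => Real.exp (-θ * X τ ω) * Real.exp (-θ * Y τ ω)) μ :=
    fun τ => (hind τ).integrable_mul (hXi τ) (hYi τ)
  have hprod : ∀ τ, (∫ ω, Real.exp (-θ * X τ ω) * Real.exp (-θ * Y τ ω) ∂μ)
      = (∫ ω, Real.exp (-θ * X τ ω) ∂μ) * (∫ ω, Real.exp (-θ * Y τ ω) ∂μ) :=
    fun τ => (hind τ).integral_fun_mul_eq_mul_integral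
      (hXi τ).aestronglyMeasurable (hYi τ).aestronglyMeasurable
  simp_rw [← hprod]
  rw [← integral_finsetSum _ (fun τ _ => hint τ)]
  refine integral_mono_of_nonneg (Filter.Eventually.of_forall fun ω => (Real.exp_pos _).le)
    (integrable_finsetSum _ fun τ _ => hint τ) (Filter.Eventually.of_forall fun ω => ?_)
  obtain ⟨τ, hτ, h⟩ := Finset.exists_mem_eq_inf' (Finset.nonempty_Icc.mpr hst)
    (fun τ => X τ ω + Y τ ω)
  simp only [h, mul_add, Real.exp_add]
  exact Finset.single_le_sum (f := fun τ => Real.exp (-θ * X τ ω) * Real.exp (-θ * Y τ ω))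
    (fun i _ => by positivity) hτ
end

section
/- Let N ≥ 1 and m ≥ 1 be natural numbers, let cl : Fin N → Fin m be a surjective classification map, let n_i = |cl^{-1}(i)| ≥ 1 be the class sizes, and let q : Fin m → ℝ. Then for every natural number T, ∑_{τ : Fin N → ℕ, ∑_j τ_j = T} ∏_{j=1}^{N} q_{cl(j)}^{τ_j} = ∑_{π : Fin m → ℕ, ∑_i π_i = T} ∏_{i=1}^{m} C(π_i + n_i − 1, n_i − 1) · q_i^{π_i}, where C(a,b) denotes the binomial coefficient. -/
theorem coeff_prod_tuple (k : ℕ) (f : Fin k → PowerSeries ℝ) (T : ℕ) :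
    PowerSeries.coeff T (∏ j, f j)
      = ∑ τ ∈ Finset.Nat.antidiagonalTuple k T, ∏ j, PowerSeries.coeff (τ j) (f j) := by
  rw [PowerSeries.coeff_prod]
  refine Finset.sum_bij' (fun l _ => (l : Fin k → ℕ))
    (fun τ _ => Finsupp.equivFunOnFinite.symm τ) ?_ ?_ ?_ ?_ ?_
  · intro l hl
    rw [Finset.mem_finsuppAntidiag] at hl
    rw [Finset.Nat.mem_antidiagonalTuple]
    exact hl.1
  · intro τ hτ
    rw [Finset.Nat.mem_antidiagonalTuple] at hτ
    rw [Finset.mem_finsuppAntidiag]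
    exact ⟨by simpa using hτ, Finset.subset_univ _⟩
  · intro l _
    ext i
    simp
  · intro τ _
    ext i
    simp
  · intro l _
    rfl

theorem coeff_geom_pow (a : ℝ) (d n : ℕ) (hd : 1 ≤ d) :
    PowerSeries.coeff n ((PowerSeries.mk fun k => a ^ k) ^ d)
      = (Nat.choose (n + d - 1) (d - 1) : ℝ) * a ^ n := by
  obtain ⟨e, rfl⟩ : ∃ e, d = e + 1 := ⟨d - 1, by omega⟩
  have h : (PowerSeries.mk fun k => a ^ k)
      = PowerSeries.rescale a (PowerSeries.mk 1 : PowerSeries ℝ) := by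
    ext k
    simp
  rw [h, ← map_pow, PowerSeries.mk_one_pow_eq_mk_choose_add, PowerSeries.coeff_rescale,
    PowerSeries.coeff_mk, mul_comm]
  congr 3
  simp
  omega

/-- Combinatorial core of Theorem 2: aggregating hops by class. For a surjective
classification `cl : Fin N → Fin m` with class sizes `n_i = |cl⁻¹(i)|` and reals
`q : Fin m → ℝ`,
`∑_{τ : ∑ τ_j = T} ∏_j q_{cl j}^{τ_j}
  = ∑_{π : ∑ π_i = T} ∏_i C(π_i + n_i - 1, n_i - 1) q_i^{π_i}`. -/
theorem stmt_3 (N m : ℕ) (hN : 1 ≤ N) (hm : 1 ≤ m)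
    (cl : Fin N → Fin m) (hsurj : Function.Surjective cl)
    (q : Fin m → ℝ) (T : ℕ) :
    ∑ τ ∈ Finset.Nat.antidiagonalTuple N T, ∏ j, q (cl j) ^ τ j
      = ∑ π ∈ Finset.Nat.antidiagonalTuple m T,
          ∏ i, (Nat.choose (π i + (Finset.univ.filter fun j => cl j = i).card - 1)
                    ((Finset.univ.filter fun j => cl j = i).card - 1) : ℝ) * q i ^ π i := by
  have key : (∏ j, (PowerSeries.mk fun k => q (cl j) ^ k : PowerSeries ℝ))
      = ∏ i, (PowerSeries.mk fun k => q i ^ k : PowerSeries ℝ)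
          ^ (Finset.univ.filter fun j => cl j = i).card := by
    rw [← Finset.prod_fiberwise Finset.univ cl]
    refine Finset.prod_congr rfl fun i _ => ?_
    rw [← Finset.prod_const]
    refine Finset.prod_congr rfl fun j hj => ?_
    rw [(Finset.mem_filter.mp hj).2]
  have h := congrArg (PowerSeries.coeff T) key
  rw [coeff_prod_tuple, coeff_prod_tuple] at h
  simp only [PowerSeries.coeff_mk] at h
  rw [h]
  refine Finset.sum_congr rfl fun π _ => Finset.prod_congr rfl fun i _ => ?_
  refine coeff_geom_pow _ _ _ (Finset.card_pos.mpr ?_)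
  obtain ⟨j, hj⟩ := hsurj i
  exact ⟨j, by simp [hj]⟩
end

section
/- For all natural numbers n, τ, k with τ ≤ k, the binomial coefficients satisfy C(n+k, k) ≤ C(n+k−τ, k−τ) · C(n+τ, τ). -/
theorem shift_aux (m t n : ℕ) :
    Nat.choose (n + (m + t)) n ≤ Nat.choose (n + m) n * Nat.choose (n + t) n := by
  induction n with
  | zero => simp
  | succ n ih =>
    have key : ∀ a : ℕ, (n + a + 1) * Nat.choose (n + a) n
        = Nat.choose (n + 1 + a) (n + 1) * (n + 1) := by
      intro a
      rw [show n + 1 + a = n + a + 1 by ring]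
      exact Nat.add_one_mul_choose_eq (n + a) n
    have h1 := key (m + t)
    have h2 := key m
    have h3 := key t
    have hpos : 0 < (n + 1) * (n + 1) := by positivity
    refine Nat.le_of_mul_le_mul_right ?_ hpos
    calc Nat.choose (n + 1 + (m + t)) (n + 1) * ((n + 1) * (n + 1))
        = ((n + (m + t) + 1) * (n + 1)) * Nat.choose (n + (m + t)) n := by
          rw [← mul_assoc, ← h1]; ring
      _ ≤ ((n + m + 1) * (n + t + 1)) * (Nat.choose (n + m) n * Nat.choose (n + t) n) := by
          refine Nat.mul_le_mul ?_ ih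
          nlinarith [Nat.zero_le (m * t)]
      _ = ((n + m + 1) * Nat.choose (n + m) n) * ((n + t + 1) * Nat.choose (n + t) n) := by ring
      _ = _ := by rw [h2, h3]; ring

/-- Shift inequality for binomial coefficients (key step of the bound `G₁` of Lemma 2):
for `τ ≤ k`, `C(n+k, k) ≤ C(n+k-τ, k-τ) · C(n+τ, τ)`. -/
theorem stmt_7 (n τ k : ℕ) (h : τ ≤ k) :
    Nat.choose (n + k) k ≤ Nat.choose (n + k - τ) (k - τ) * Nat.choose (n + τ) τ := by
  obtain ⟨m, rfl⟩ := Nat.exists_eq_add_of_le' h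
  rw [show n + (m + τ) - τ = n + m by omega, show m + τ - τ = m by omega,
    ← Nat.choose_symm_add, ← Nat.choose_symm_add, ← Nat.choose_symm_add]
  exact shift_aux m τ n
end

section
/- For all natural numbers n and τ and every real x with 0 ≤ x < 1, the tail of the binomially weighted geometric series satisfies ∑_{k=τ}^{∞} C(n+k, k) x^k ≤ min(1, x^τ · C(n+τ, n)) / (1−x)^{n+1}. -/
theorem choose_aux (n t k : ℕ) :
    (n + (t + k)).choose n ≤ (n + t).choose n * (n + k).choose n := by
  induction k with
  | zero => simp
  | succ k ih =>
    have h1 := Nat.choose_mul_succ_eq (n + (t + k)) n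
    have h2 := Nat.choose_mul_succ_eq (n + k) n
    rw [show n + (t + k) + 1 - n = t + k + 1 by omega] at h1
    rw [show n + k + 1 - n = k + 1 by omega] at h2
    rw [show n + (t + (k + 1)) = n + (t + k) + 1 by omega,
      show n + (k + 1) = n + k + 1 by omega]
    generalize (n + (t + k) + 1).choose n = a2 at *
    generalize (n + k + 1).choose n = b2 at *
    generalize (n + (t + k)).choose n = a at *
    generalize (n + k).choose n = b at *
    generalize (n + t).choose n = c at *
    have hp : 0 < (t + k + 1) * (k + 1) := by positivity
    refine Nat.le_of_mul_le_mul_right ?_ hp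
    calc a2 * ((t + k + 1) * (k + 1)) = a * ((n + (t + k) + 1) * (k + 1)) := by
          rw [← mul_assoc, ← h1, mul_assoc]
      _ ≤ (c * b) * ((n + k + 1) * (t + k + 1)) := by
          refine Nat.mul_le_mul ih ?_
          nlinarith [Nat.zero_le (n * t)]
      _ = c * (b * (n + k + 1)) * (t + k + 1) := by ring
      _ = c * b2 * ((t + k + 1) * (k + 1)) := by rw [h2]; ring

/-- Bound `G₁` of Lemma 2: for `0 ≤ x < 1`, the tail of the binomially weighted geometric
series satisfies `∑_{k=τ}^∞ C(n+k,k) x^k ≤ min(1, x^τ C(n+τ,n)) / (1-x)^{n+1}`. -/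
theorem stmt_8 (n τ : ℕ) (x : ℝ) (hx0 : 0 ≤ x) (hx1 : x < 1) :
    (∑' k : ℕ, (Nat.choose (n + (τ + k)) (τ + k) : ℝ) * x ^ (τ + k))
      ≤ min 1 (x ^ τ * (Nat.choose (n + τ) n : ℝ)) / (1 - x) ^ (n + 1) := by
  have hs : HasSum (fun k : ℕ => ((n + k).choose n : ℝ) * x ^ k) (1 / (1 - x) ^ (n + 1)) := by
    have := hasSum_choose_mul_geometric_of_norm_lt_one n (r := x)
      (by rwa [Real.norm_of_nonneg hx0])
    simpa only [add_comm n] using this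
  have hc : ∀ k : ℕ, (n + k).choose k = (n + k).choose n := fun k =>
    (Nat.choose_symm_add).symm
  simp only [hc]
  have hinj : Function.Injective (fun k : ℕ => τ + k) := add_right_injective τ
  have hs2 : Summable (fun k : ℕ => ((n + (τ + k)).choose n : ℝ) * x ^ (τ + k)) :=
    hs.summable.comp_injective hinj
  have hpos : 0 < (1 - x) ^ (n + 1) := pow_pos (by linarith) _
  rw [← min_div_div_right hpos.le]
  refine le_min ?_ ?_
  · rw [← hs.tsum_eq]
    exact hs2.tsum_le_tsum_of_inj _ hinj (fun c _ => by positivity) (fun k => le_rfl) hs.summable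
  · have h3 := hs.mul_left (x ^ τ * ((n + τ).choose n : ℝ))
    rw [mul_one_div] at h3
    rw [← h3.tsum_eq]
    refine hs2.tsum_le_tsum (fun k => ?_) h3.summable
    have h : ((n + (τ + k)).choose n : ℝ) ≤ (n + τ).choose n * (n + k).choose n := by
      exact_mod_cast choose_aux n τ k
    calc _ ≤ ((n + τ).choose n * (n + k).choose n : ℝ) * x ^ (τ + k) := by gcongr
      _ = _ := by rw [pow_add]; ring
end

section
/- For all natural numbers n and τ with τ ≥ 1 and every real x with 0 ≤ x < 1, the tail of the binomially weighted geometric series satisfies ∑_{k=τ}^{∞} C(n+k, k) x^k ≤ 1/(1−x)^{n+1} − C(n+τ, n+1) · x^{τ−1}. -/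
/-- Bound `G₂` of Lemma 2: for `τ ≥ 1` and `0 ≤ x < 1`,
`∑_{k=τ}^∞ C(n+k,k) x^k ≤ 1/(1-x)^{n+1} - C(n+τ, n+1) x^{τ-1}`. -/
theorem stmt_9 (n τ : ℕ) (hτ : 1 ≤ τ) (x : ℝ) (hx0 : 0 ≤ x) (hx1 : x < 1) :
    (∑' k : ℕ, (Nat.choose (n + (τ + k)) (τ + k) : ℝ) * x ^ (τ + k))
      ≤ 1 / (1 - x) ^ (n + 1) - (Nat.choose (n + τ) (n + 1) : ℝ) * x ^ (τ - 1) := by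
  obtain ⟨t, rfl⟩ : ∃ t, τ = t + 1 := ⟨τ - 1, by omega⟩
  have hs : HasSum (fun k : ℕ => ((k + n).choose n : ℝ) * x ^ k) (1 / (1 - x) ^ (n + 1)) :=
    hasSum_choose_mul_geometric_of_norm_lt_one n
      (by rw [Real.norm_eq_abs, abs_of_nonneg hx0]; exact hx1)
  have h1 := hs.summable.sum_add_tsum_nat_add (t + 1)
  rw [hs.tsum_eq] at h1
  have h2 : (∑' k : ℕ, (Nat.choose (n + (t + 1 + k)) (t + 1 + k) : ℝ) * x ^ (t + 1 + k))
      = ∑' k : ℕ, ((k + (t + 1) + n).choose n : ℝ) * x ^ (k + (t + 1)) := by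
    refine tsum_congr fun k => ?_
    rw [add_comm (t + 1) k, ← Nat.choose_symm_add, add_comm n]
  have h3 : ((n + (t + 1)).choose (n + 1) : ℝ) * x ^ t
      ≤ ∑ k ∈ Finset.range (t + 1), ((k + n).choose n : ℝ) * x ^ k := by
    have h4 : (n + (t + 1)).choose (n + 1) = ∑ k ∈ Finset.range (t + 1), (k + n).choose n := by
      rw [Nat.sum_range_add_choose]
      congr 1
      omega
    rw [h4, Nat.cast_sum, Finset.sum_mul]
    refine Finset.sum_le_sum fun k hk => ?_
    refine mul_le_mul_of_nonneg_left ?_ (Nat.cast_nonneg _)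
    exact pow_le_pow_of_le_one hx0 hx1.le (by have := Finset.mem_range.1 hk; omega)
  rw [h2, Nat.add_sub_cancel]
  linarith
end

section
/- Let m ≥ 2 and n+1 ≥ m be natural numbers, let n_1, …, n_m ≥ 1 be natural numbers with n_1 + ⋯ + n_m = n+1, let τ be a natural number, and let V_1, …, V_m be pairwise distinct reals with 0 < V_i < 1 for all i. Then ∑_{u=τ}^{∞} ∑_{π_1+⋯+π_m=u, π_i ≥ 0} ∏_{i=1}^{m} C(π_i + n_i − 1, n_i − 1) V_i^{π_i} ≤ ∑_{i=1}^{m} ψ_i · V_i^{m−1} · ∑_{u=τ}^{∞} C(u+n+1−m, n+1−m) V_i^{u}, where ψ_i = ∏_{j ≠ i} (V_i − V_j)^{−1}, and all series involved converge. -/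
lemma aux_erase {k : ℕ} (i : Fin k) (f : Fin k → ℝ) :
    ∏ j ∈ Finset.univ.erase i, f j = ∏ j, if j = i then 1 else f j := by
  rw [← Finset.mul_prod_erase Finset.univ _ (Finset.mem_univ i)]
  simp only [if_true, one_mul]
  refine Finset.prod_congr rfl fun j hj => ?_
  rw [if_neg (Finset.ne_of_mem_erase hj)]

lemma aux_erase_succ {k : ℕ} (i : Fin k) (f : Fin (k + 1) → ℝ) :
    ∏ j ∈ Finset.univ.erase i.succ, f j
      = f 0 * ∏ j ∈ Finset.univ.erase i, f j.succ := by
  rw [aux_erase, aux_erase, Fin.prod_univ_succ, if_neg (Fin.succ_ne_zero i).symm]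
  simp [Fin.succ_inj]

lemma aux_sum_succ (k n : ℕ) (f : (Fin (k + 1) → ℕ) → ℝ) :
    ∑ π ∈ Finset.Nat.antidiagonalTuple (k + 1) n, f π
      = ∑ p ∈ Finset.HasAntidiagonal.antidiagonal n, ∑ x ∈ Finset.Nat.antidiagonalTuple k p.2,
          f (Fin.cons p.1 x) := by
  rw [Finset.sum_sigma']
  symm
  refine Finset.sum_bij (fun a _ => Fin.cons a.1.1 a.2) ?_ ?_ ?_ ?_
  · rintro ⟨⟨a, b⟩, x⟩ h
    simp only [Finset.mem_sigma, Finset.HasAntidiagonal.mem_antidiagonal,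
      Finset.Nat.mem_antidiagonalTuple] at h ⊢
    rw [Fin.sum_cons]
    omega
  · rintro ⟨⟨a, b⟩, x⟩ h ⟨⟨a', b'⟩, x'⟩ h' e
    simp only [Finset.mem_sigma, Finset.HasAntidiagonal.mem_antidiagonal,
      Finset.Nat.mem_antidiagonalTuple] at h h'
    simp only [Fin.cons_inj] at e
    obtain ⟨rfl, rfl⟩ := e
    obtain rfl : b = b' := by omega
    rfl
  · intro π h
    rw [Finset.Nat.mem_antidiagonalTuple, Fin.sum_univ_succ] at h
    refine ⟨⟨(π 0, ∑ i : Fin k, π i.succ), fun i => π i.succ⟩, ?_, ?_⟩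
    · simp [Finset.Nat.mem_antidiagonalTuple, h]
    · exact Fin.cons_self_tail π
  · intros; rfl

lemma aux_vanish (k : ℕ) (V : Fin (k + 2) → ℝ) (hV : Function.Injective V) :
    ∑ i, (∏ j ∈ Finset.univ.erase i, (V i - V j)⁻¹) * V i ^ k = 0 := by
  have h := Lagrange.coeff_eq_sum (s := Finset.univ) (v := V) hV.injOn
    (P := (Polynomial.X : Polynomial ℝ) ^ k) (by
      rw [Polynomial.degree_X_pow]; simp only [Finset.card_univ, Fintype.card_fin]
      exact_mod_cast (by omega : k < k + 2))
  rw [Polynomial.coeff_X_pow, if_neg (by simp)] at h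
  rw [h]
  refine Finset.sum_congr rfl fun i _ => ?_
  rw [Finset.prod_inv_distrib]
  simp [div_eq_mul_inv, mul_comm]

lemma aux_geom (x y : ℝ) (h : x - y ≠ 0) (u : ℕ) :
    ∑ p ∈ Finset.HasAntidiagonal.antidiagonal u, y ^ p.1 * x ^ p.2
      = (x - y)⁻¹ * (x ^ (u + 1) - y ^ (u + 1)) := by
  rw [eq_inv_mul_iff_mul_eq₀ h, Finset.Nat.sum_antidiagonal_eq_sum_range_succ_mk]
  have := (Commute.all y x).geom_sum₂_mul (u + 1)
  simp only [Nat.add_sub_cancel] at this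
  simp only [Nat.succ_eq_add_one]
  linarith

lemma aux_hsymm (k : ℕ) : ∀ (u : ℕ) (V : Fin (k + 1) → ℝ), Function.Injective V →
    ∑ π ∈ Finset.Nat.antidiagonalTuple (k + 1) u, ∏ i, V i ^ π i
      = ∑ i, (∏ j ∈ Finset.univ.erase i, (V i - V j)⁻¹) * V i ^ (k + u) := by
  induction k with
  | zero =>
    intro u V _
    simp
  | succ k ih =>
    intro u V hV
    rw [aux_sum_succ]
    have hV' : Function.Injective (fun i : Fin (k + 1) => V i.succ) :=
      hV.comp (Fin.succ_injective _)
    have h0 := aux_vanish k V hV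
    have hne : ∀ i : Fin (k + 1), V i.succ - V 0 ≠ 0 := fun i =>
      sub_ne_zero.2 fun h => Fin.succ_ne_zero i (hV h)
    calc _ = ∑ p ∈ Finset.HasAntidiagonal.antidiagonal u, ∑ i : Fin (k + 1),
          (∏ j ∈ Finset.univ.erase i, (V i.succ - V j.succ)⁻¹) * V i.succ ^ k *
            (V 0 ^ p.1 * V i.succ ^ p.2) := by
          refine Finset.sum_congr rfl fun p _ => ?_
          simp only [Fin.prod_univ_succ, Fin.cons_zero, Fin.cons_succ]
          rw [← Finset.mul_sum]
          have := ih p.2 _ hV'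
          simp only [Fin.prod_univ_succ] at this
          rw [this, Finset.mul_sum]
          refine Finset.sum_congr rfl fun i _ => ?_
          rw [pow_add]; ring
      _ = ∑ i : Fin (k + 1),
          (∏ j ∈ Finset.univ.erase i.succ, (V i.succ - V j)⁻¹) * V i.succ ^ k *
            (V i.succ ^ (u + 1) - V 0 ^ (u + 1)) := by
          rw [Finset.sum_comm]
          refine Finset.sum_congr rfl fun i _ => ?_
          rw [← Finset.mul_sum, aux_geom _ _ (hne i), aux_erase_succ]
          ring
      _ = _ := by
          rw [Fin.sum_univ_succ] at h0
          rw [Fin.sum_univ_succ (n := k + 1)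
            (f := fun i => (∏ j ∈ Finset.univ.erase i, (V i - V j)⁻¹) * V i ^ (k + 1 + u))]
          simp only [mul_sub, Finset.sum_sub_distrib]
          rw [← Finset.sum_mul]
          have e : ∀ i : Fin (k + 1),
              (∏ j ∈ Finset.univ.erase i.succ, (V i.succ - V j)⁻¹) * V i.succ ^ (k + 1 + u)
              = (∏ j ∈ Finset.univ.erase i.succ, (V i.succ - V j)⁻¹) * V i.succ ^ k *
                V i.succ ^ (u + 1) := fun i => by ring
          rw [Finset.sum_congr rfl fun i _ => e i]
          linear_combination (- V 0 ^ (u + 1)) * h0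

lemma aux_choose2 (p q a b : ℕ) :
    (p + a).choose a * (q + b).choose b ≤ (p + q + (a + b)).choose (a + b) := by
  rw [show p + q + (a + b) = (p + a) + (q + b) by ring, Nat.add_choose_eq (p + a) (q + b)]
  exact Finset.single_le_sum (f := fun ij : ℕ × ℕ => (p + a).choose ij.1 * (q + b).choose ij.2)
    (fun _ _ => Nat.zero_le _) (Finset.HasAntidiagonal.mem_antidiagonal.2 (rfl : (a, b).1 + (a, b).2 = a + b))

lemma aux_choose {ι : Type*} (s : Finset ι) (p a : ι → ℕ) :
    ∏ i ∈ s, (p i + a i).choose (a i)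
      ≤ (∑ i ∈ s, p i + ∑ i ∈ s, a i).choose (∑ i ∈ s, a i) := by
  classical
  induction s using Finset.induction_on with
  | empty => simp
  | insert i s hi ih =>
    rw [Finset.prod_insert hi, Finset.sum_insert hi, Finset.sum_insert hi]
    exact (Nat.mul_le_mul_left _ ih).trans (aux_choose2 _ _ _ _)

/-- Analytic core of Theorem 3 (heterogeneous case `m ≥ 2`): with class sizes `n_i ≥ 1`
summing to `n+1` and pairwise distinct `V_i ∈ (0,1)`, all series converge and
`∑_{u=τ}^∞ ∑_{π_1+⋯+π_m=u} ∏_i C(π_i+n_i-1, n_i-1) V_i^{π_i}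
  ≤ ∑_i ψ_i V_i^{m-1} ∑_{u=τ}^∞ C(u+n+1-m, n+1-m) V_i^u`,
where `ψ_i = ∏_{j≠i} (V_i - V_j)⁻¹`. -/
theorem stmt_10 (m n : ℕ) (hm : 2 ≤ m) (hmn : m ≤ n + 1)
    (nc : Fin m → ℕ) (hnc : ∀ i, 1 ≤ nc i) (hsum : ∑ i, nc i = n + 1)
    (τ : ℕ) (V : Fin m → ℝ) (hV0 : ∀ i, 0 < V i) (hV1 : ∀ i, V i < 1)
    (hdist : Function.Injective V) :
    Summable (fun u : ℕ => ∑ π ∈ Finset.Nat.antidiagonalTuple m (τ + u),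
        ∏ i, (Nat.choose (π i + nc i - 1) (nc i - 1) : ℝ) * V i ^ π i) ∧
    (∀ i, Summable (fun u : ℕ =>
        (Nat.choose (τ + u + n + 1 - m) (n + 1 - m) : ℝ) * V i ^ (τ + u))) ∧
    (∑' u : ℕ, ∑ π ∈ Finset.Nat.antidiagonalTuple m (τ + u),
        ∏ i, (Nat.choose (π i + nc i - 1) (nc i - 1) : ℝ) * V i ^ π i)
      ≤ ∑ i, (∏ j ∈ Finset.univ.erase i, (V i - V j)⁻¹) * V i ^ (m - 1) *
          ∑' u : ℕ, (Nat.choose (τ + u + n + 1 - m) (n + 1 - m) : ℝ) * V i ^ (τ + u) := by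
  have hA : ∑ i, (nc i - 1) = n + 1 - m := by
    have : ∑ i, (nc i - 1) + m = n + 1 := by
      rw [← hsum]
      have h : ∑ i : Fin m, nc i = ∑ i : Fin m, ((nc i - 1) + 1) :=
        Finset.sum_congr rfl fun i _ => by have := hnc i; omega
      rw [h, Finset.sum_add_distrib]; simp
    omega
  have hS : ∀ i, Summable (fun u : ℕ =>
        (Nat.choose (τ + u + n + 1 - m) (n + 1 - m) : ℝ) * V i ^ (τ + u)) := by
    intro i
    have h := summable_choose_mul_geometric_of_norm_lt_one (R := ℝ) (n + 1 - m) (r := V i)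
      (by rw [Real.norm_of_nonneg (hV0 i).le]; exact hV1 i)
    have h2 := (summable_nat_add_iff τ).2 h
    refine h2.congr fun u => ?_
    rw [show τ + u + n + 1 - m = u + τ + (n + 1 - m) by omega, add_comm τ u]
  have hpt : ∀ u : ℕ, ∑ π ∈ Finset.Nat.antidiagonalTuple m (τ + u),
        ∏ i, (Nat.choose (π i + nc i - 1) (nc i - 1) : ℝ) * V i ^ π i
      ≤ ∑ i, (∏ j ∈ Finset.univ.erase i, (V i - V j)⁻¹) * V i ^ (m - 1) *
        ((Nat.choose (τ + u + n + 1 - m) (n + 1 - m) : ℝ) * V i ^ (τ + u)) := by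
    intro u
    calc _ ≤ ∑ π ∈ Finset.Nat.antidiagonalTuple m (τ + u),
          (Nat.choose (τ + u + n + 1 - m) (n + 1 - m) : ℝ) * ∏ i, V i ^ π i := by
          refine Finset.sum_le_sum fun π hπ => ?_
          rw [Finset.Nat.mem_antidiagonalTuple] at hπ
          rw [Finset.prod_mul_distrib]
          refine mul_le_mul_of_nonneg_right ?_
            (Finset.prod_nonneg fun i _ => pow_nonneg (hV0 i).le _)
          have h := aux_choose Finset.univ π (fun i => nc i - 1)
          rw [hπ, hA] at h
          rw [show τ + u + n + 1 - m = τ + u + (n + 1 - m) by omega]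
          refine le_trans (le_of_eq ?_) (Nat.cast_le (α := ℝ).2 h)
          push_cast
          refine Finset.prod_congr rfl fun i _ => ?_
          rw [Nat.add_sub_assoc (hnc i)]
      _ = _ := by
          obtain ⟨k, rfl⟩ : ∃ k, m = k + 1 := ⟨m - 1, by omega⟩
          rw [← Finset.mul_sum, aux_hsymm k _ V hdist, Finset.mul_sum]
          refine Finset.sum_congr rfl fun i _ => ?_
          rw [Nat.add_sub_cancel, pow_add]
          ring
  have hR : Summable (fun u : ℕ => ∑ i, (∏ j ∈ Finset.univ.erase i, (V i - V j)⁻¹) *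
      V i ^ (m - 1) *
        ((Nat.choose (τ + u + n + 1 - m) (n + 1 - m) : ℝ) * V i ^ (τ + u))) :=
    summable_sum fun i _ => (hS i).mul_left _
  have hL := Summable.of_nonneg_of_le (fun u => Finset.sum_nonneg fun π _ =>
    Finset.prod_nonneg fun i _ => mul_nonneg (Nat.cast_nonneg _) (pow_nonneg (hV0 i).le _)) hpt hR
  refine ⟨hL, hS, (hL.tsum_le_tsum hpt hR).trans (le_of_eq ?_)⟩
  rw [Summable.tsum_finsetSum fun i _ => (hS i).mul_left _]
  exact Finset.sum_congr rfl fun i _ => tsum_mul_left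
end

section
/- Let n be a natural number, θ > 0, δ_b ≥ 0 real, and let p > 0 and q ≥ 0 be reals with p·q < 1. Suppose A and S̄ are nonnegative real-valued functions on pairs of naturals satisfying A(u,t) ≤ e^{θδ_b} · p^{t−u} for all u ≤ t and S̄(u,s) ≤ C(s−u+n, n) · q^{s−u} for all u ≤ s. Then for all natural numbers s and t, ∑_{u=0}^{min(s,t)} A(u,t) · S̄(u,s) ≤ e^{θδ_b} · p^{t−s} · G_{τ,n}(p·q), where τ = max(s−t, 0), p^{t−s} denotes the (possibly negative-exponent) real power, and G_{τ,n}(x) = min{ min(1, x^τ C(n+τ,n))/(1−x)^{n+1}, 1/(1−x)^{n+1} − C(n+τ, n+1) x^{τ−1} } for 0 ≤ x < 1 (with the second argument of the min taken to be 1/(1−x)^{n+1} when τ = 0). -/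
theorem aux_choose_mul (a b n : ℕ) :
    Nat.choose (a + b + n) n ≤ Nat.choose (a + n) n * Nat.choose (b + n) n := by
  induction n with
  | zero => simp
  | succ n ih =>
    have h1 := Nat.add_one_mul_choose_eq (a + b + n) n
    have h2 := Nat.add_one_mul_choose_eq (a + n) n
    have h3 := Nat.add_one_mul_choose_eq (b + n) n
    have key : Nat.choose (a + b + n + 1) (n + 1) * ((n + 1) * (n + 1)) ≤
        (Nat.choose (a + n + 1) (n + 1) * Nat.choose (b + n + 1) (n + 1)) * ((n + 1) * (n + 1)) := by
      calc _ = (Nat.choose (a + b + n + 1) (n + 1) * (n + 1)) * (n + 1) := by ring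
        _ = Nat.choose (a + b + n) n * ((a + b + n + 1) * (n + 1)) := by rw [← h1]; ring
        _ ≤ (Nat.choose (a + n) n * Nat.choose (b + n) n) * ((a + n + 1) * (b + n + 1)) := by
          apply Nat.mul_le_mul ih
          nlinarith [Nat.zero_le (a * b)]
        _ = ((a + n + 1) * Nat.choose (a + n) n) * ((b + n + 1) * Nat.choose (b + n) n) := by ring
        _ = _ := by rw [h2, h3]; ring
    exact Nat.le_of_mul_le_mul_right key (by positivity)

theorem aux_hockey (n τ : ℕ) :
    ∑ k ∈ Finset.range τ, Nat.choose (k + n) n = Nat.choose (n + τ) (n + 1) := by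
  induction τ with
  | zero => simp
  | succ k ih =>
    rw [Finset.sum_range_succ, ih, ← add_assoc, Nat.choose_succ_succ, add_comm k n, add_comm]

theorem aux_partial (n N : ℕ) (x : ℝ) (hx0 : 0 ≤ x) (hx1 : x < 1) :
    ∑ k ∈ Finset.range N, (Nat.choose (k + n) n : ℝ) * x ^ k ≤ 1 / (1 - x) ^ (n + 1) :=
  sum_le_hasSum _ (fun k _ => by positivity)
    (hasSum_choose_mul_geometric_of_norm_lt_one n (by rwa [Real.norm_of_nonneg hx0]))

theorem aux_G (n τ m : ℕ) (x : ℝ) (hx0 : 0 ≤ x) (hx1 : x < 1) :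
    ∑ j ∈ Finset.range m, (Nat.choose (τ + j + n) n : ℝ) * x ^ (τ + j) ≤
      min (min 1 (x ^ τ * (Nat.choose (n + τ) n : ℝ)) / (1 - x) ^ (n + 1))
        (1 / (1 - x) ^ (n + 1) - (Nat.choose (n + τ) (n + 1) : ℝ) * x ^ (τ - 1)) := by
  have hpos : 0 < (1 - x) ^ (n + 1) := pow_pos (by linarith) _
  have hsplit := Finset.sum_range_add (fun k => (Nat.choose (k + n) n : ℝ) * x ^ k) τ m
  have hfull := aux_partial n (τ + m) x hx0 hx1
  have hhead : (Nat.choose (n + τ) (n + 1) : ℝ) * x ^ (τ - 1) ≤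
      ∑ k ∈ Finset.range τ, (Nat.choose (k + n) n : ℝ) * x ^ k := by
    rw [← aux_hockey, Nat.cast_sum, Finset.sum_mul]
    apply Finset.sum_le_sum
    intro k hk
    have hk' := Finset.mem_range.mp hk
    exact mul_le_mul_of_nonneg_left
      (pow_le_pow_of_le_one hx0 hx1.le (by omega)) (by positivity)
  have hh0 : 0 ≤ (Nat.choose (n + τ) (n + 1) : ℝ) * x ^ (τ - 1) := by positivity
  refine le_min ?_ (by linarith)
  rw [← min_div_div_right hpos.le]
  refine le_min (by linarith) ?_
  calc _ ≤ ∑ j ∈ Finset.range m, (x ^ τ * (Nat.choose (n + τ) n : ℝ)) *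
        ((Nat.choose (j + n) n : ℝ) * x ^ j) := by
        apply Finset.sum_le_sum
        intro j _
        have h : (Nat.choose (τ + j + n) n : ℝ) ≤
            (Nat.choose (n + τ) n : ℝ) * (Nat.choose (j + n) n : ℝ) := by
          rw [add_comm n τ]; exact_mod_cast aux_choose_mul τ j n
        calc _ ≤ ((Nat.choose (n + τ) n : ℝ) * (Nat.choose (j + n) n : ℝ)) * x ^ (τ + j) :=
              mul_le_mul_of_nonneg_right h (by positivity)
          _ = _ := by rw [pow_add]; ring
    _ ≤ _ := by
        rw [← Finset.mul_sum, div_eq_mul_one_div]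
        exact mul_le_mul_of_nonneg_left (aux_partial n m x hx0 hx1) (by positivity)


/-- Theorem 4 (homogeneous case): if `A(u,t) ≤ e^{θδ_b} p^{t-u}` and
`S̄(u,s) ≤ C(s-u+n, n) q^{s-u}` with `p q < 1`, then for all `s t`,
`∑_{u=0}^{min(s,t)} A(u,t) S̄(u,s) ≤ e^{θδ_b} p^{t-s} G_{τ,n}(pq)` with `τ = max(s-t,0)`,
where `G_{τ,n}(x) = min( min(1, x^τ C(n+τ,n))/(1-x)^{n+1} ,
                         1/(1-x)^{n+1} - C(n+τ, n+1) x^{τ-1} )`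
(note `C(n+τ, n+1) = 0` when `τ = 0`, realizing the convention for `τ = 0`). -/
theorem stmt_11 (n : ℕ) (θ δb : ℝ) (hθ : 0 < θ) (hδb : 0 ≤ δb)
    (p q : ℝ) (hp : 0 < p) (hq : 0 ≤ q) (hpq : p * q < 1)
    (A S : ℕ → ℕ → ℝ)
    (hA0 : ∀ u t, 0 ≤ A u t) (hS0 : ∀ u s, 0 ≤ S u s)
    (hA : ∀ u t, u ≤ t → A u t ≤ Real.exp (θ * δb) * p ^ (t - u))
    (hS : ∀ u s, u ≤ s → S u s ≤ (Nat.choose (s - u + n) n : ℝ) * q ^ (s - u)) :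
    ∀ s t : ℕ,
      ∑ u ∈ Finset.range (min s t + 1), A u t * S u s
        ≤ Real.exp (θ * δb) * p ^ ((t : ℤ) - (s : ℤ)) *
            min (min 1 ((p * q) ^ (s - t) * (Nat.choose (n + (s - t)) n : ℝ))
                    / (1 - p * q) ^ (n + 1))
                (1 / (1 - p * q) ^ (n + 1)
                  - (Nat.choose (n + (s - t)) (n + 1) : ℝ) * (p * q) ^ (s - t - 1)) := by
  intro s t
  have hG := aux_G n (s - t) (min s t + 1) (p * q) (by positivity) hpq
  refine le_trans ?_ (mul_le_mul_of_nonneg_left hG (by positivity))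
  rw [← Finset.sum_range_reflect, Finset.mul_sum]
  apply Finset.sum_le_sum
  intro j hj
  have hj' := Finset.mem_range.mp hj
  obtain ⟨u, hu⟩ : ∃ u, u = min s t + 1 - 1 - j := ⟨_, rfl⟩
  rw [← hu]
  have hus : u ≤ s := by omega
  have hut : u ≤ t := by omega
  have hk : s - t + j = s - u := by omega
  rw [hk]
  have hz : p ^ (t - u) = p ^ ((t : ℤ) - (s : ℤ)) * p ^ (s - u) := by
    rw [← zpow_natCast, ← zpow_natCast, ← zpow_add₀ hp.ne']
    congr 1
    omega
  calc A u t * S u s ≤ (Real.exp (θ * δb) * p ^ (t - u)) *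
        ((Nat.choose (s - u + n) n : ℝ) * q ^ (s - u)) :=
        mul_le_mul (hA u t hut) (hS u s hus) (hS0 u s) (by positivity)
    _ = _ := by rw [hz, mul_pow]; ring
end

section
/- Let m ≥ 1 and n be natural numbers and let x_1, …, x_m be nonnegative real numbers. Then ∑_{i_1+⋯+i_m=n, i_k ≥ 0} ∏_{k=1}^{m} x_k^{i_k} ≥ C(n+m−1, m−1) · ((x_1+⋯+x_m)/m)^n. Moreover, if m ≥ 2 and n ≥ 2, equality holds if and only if x_1 = x_2 = ⋯ = x_m. -/
namespace Haber

/-- complete homogeneous symmetric polynomial -/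
noncomputable def h {m : ℕ} (x : Fin m → ℝ) (n : ℕ) : ℝ :=
  ∑ k ∈ Finset.Nat.antidiagonalTuple m n, ∏ i, x i ^ k i

/-- the same with the variable `x i` doubled -/
noncomputable def g {m : ℕ} (x : Fin m → ℝ) (i : Fin m) (n : ℕ) : ℝ :=
  ∑ k ∈ Finset.Nat.antidiagonalTuple m n, ((k i : ℝ) + 1) * ∏ j, x j ^ k j

/-- both `x i` and `x j` doubled -/
noncomputable def f {m : ℕ} (x : Fin m → ℝ) (i j : Fin m) : ℕ → ℝ
  | 0 => 1
  | n + 1 => g x i (n + 1) + x j * f x i j n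

lemma h_zero {m : ℕ} (x : Fin m → ℝ) : h x 0 = 1 := by
  simp [h, Finset.Nat.antidiagonalTuple_zero_right]

lemma g_zero {m : ℕ} (x : Fin m → ℝ) (i) : g x i 0 = 1 := by
  simp [g, Finset.Nat.antidiagonalTuple_zero_right]

lemma h_nonneg {m : ℕ} (x : Fin m → ℝ) (hx : ∀ i, 0 ≤ x i) (n) : 0 ≤ h x n :=
  Finset.sum_nonneg fun _ _ => Finset.prod_nonneg fun i _ => pow_nonneg (hx i) _

lemma g_succ {m : ℕ} (x : Fin m → ℝ) (i : Fin m) (n : ℕ) :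
    g x i (n + 1) = h x (n + 1) + x i * g x i n := by
  have key : ∑ k ∈ Finset.Nat.antidiagonalTuple m (n + 1), (k i : ℝ) * ∏ j, x j ^ k j
      = x i * g x i n := by
    rw [g, Finset.mul_sum]
    symm
    apply Finset.sum_bij_ne_zero (fun k _ _ => k + Pi.single i 1)
    · intro k hk _
      rw [Finset.Nat.mem_antidiagonalTuple] at hk ⊢
      simp [Finset.sum_add_distrib, hk]
    · intro a _ _ b _ _ hab
      exact add_right_cancel hab
    · intro b hb hne
      have hbi : b i ≠ 0 := by
        intro h0
        simp [h0] at hne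
      have hb1 : (b - Pi.single i 1) + Pi.single i 1 = b := by
        funext j
        by_cases hj : j = i
        · subst hj
          simp
          omega
        · simp [hj]
      have hterm : ∀ k : Fin m → ℕ, x i * (((k i : ℝ) + 1) * ∏ j, x j ^ k j)
          = (((k + Pi.single i 1 : Fin m → ℕ) i : ℕ) : ℝ)
            * ∏ j, x j ^ (k + Pi.single i 1 : Fin m → ℕ) j := by
        intro k
        simp only [Pi.add_apply, pow_add, Finset.prod_mul_distrib]
        have : ∏ j, x j ^ (Pi.single i 1 : Fin m → ℕ) j = x i := by
          rw [Finset.prod_eq_single i] <;> simp +contextual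
        rw [this]
        simp
        ring
      refine ⟨b - Pi.single i 1, ?_, ?_, hb1⟩
      · rw [Finset.Nat.mem_antidiagonalTuple] at hb ⊢
        rw [← hb1] at hb
        simpa [Finset.sum_add_distrib] using hb
      · rw [hterm, hb1]
        exact hne
    · intro k _ _
      simp only [Pi.add_apply, pow_add, Finset.prod_mul_distrib]
      have : ∏ j, x j ^ (Pi.single i 1 : Fin m → ℕ) j = x i := by
        rw [Finset.prod_eq_single i] <;> simp +contextual
      rw [this]
      simp
      ring
  rw [← key, g, h, ← Finset.sum_add_distrib]
  exact Finset.sum_congr rfl fun k _ => by ring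

lemma sum_g {m : ℕ} (x : Fin m → ℝ) (n : ℕ) : ∑ i, g x i n = (n + m) * h x n := by
  simp only [g, h]
  rw [Finset.sum_comm, Finset.mul_sum]
  refine Finset.sum_congr rfl fun k hk => ?_
  rw [← Finset.sum_mul, Finset.sum_add_distrib]
  rw [Finset.Nat.mem_antidiagonalTuple] at hk
  rw [← hk]
  simp

lemma sum_xg {m : ℕ} (x : Fin m → ℝ) (n : ℕ) :
    ∑ i, x i * g x i n = (n + 1) * h x (n + 1) := by
  have h1 := sum_g x (n + 1)
  simp only [g_succ, Finset.sum_add_distrib] at h1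
  simp at h1
  linarith

lemma g_sub {m : ℕ} (x : Fin m → ℝ) (i j : Fin m) (n : ℕ) :
    g x i (n + 1) - g x j (n + 1) = (x i - x j) * f x i j n := by
  induction n with
  | zero => simp [g_succ, g_zero, f]
  | succ n ih =>
    rw [g_succ x i (n + 1), g_succ x j (n + 1), f]
    linear_combination x j * ih

lemma g_ge {m : ℕ} (x : Fin m → ℝ) (hx : ∀ i, 0 ≤ x i) (i : Fin m) (n : ℕ) :
    x i ^ n ≤ g x i n := by
  induction n with
  | zero => simp [g_zero]
  | succ n ih =>
    rw [g_succ, pow_succ']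
    nlinarith [h_nonneg x hx (n + 1), mul_le_mul_of_nonneg_left ih (hx i)]

lemma f_ge {m : ℕ} (x : Fin m → ℝ) (hx : ∀ i, 0 ≤ x i) (i j : Fin m) (n : ℕ) :
    x j ^ n ≤ f x i j n ∧ x i ^ n ≤ f x i j n := by
  induction n with
  | zero => simp [f]
  | succ n ih =>
    have h1 := g_ge x hx i (n + 1)
    have h2 := pow_nonneg (hx i) (n + 1)
    have h3 := mul_le_mul_of_nonneg_left ih.1 (hx j)
    have h4 := pow_nonneg (hx j) (n + 1)
    rw [← pow_succ'] at h3
    rw [f]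
    constructor <;> linarith

lemma cheb {m : ℕ} (x : Fin m → ℝ) (n : ℕ) :
    2 * ((m : ℝ) * (n + 1) * h x (n + 1) - (n + m) * (∑ i, x i) * h x n)
      = ∑ i, ∑ j, (x i - x j) * (g x i n - g x j n) := by
  have e : ∀ i j, (x i - x j) * (g x i n - g x j n)
      = x i * g x i n - x i * g x j n - g x i n * x j + x j * g x j n := by
    intro i j; ring
  simp only [e, Finset.sum_add_distrib, Finset.sum_sub_distrib, ← Finset.mul_sum,
    ← Finset.sum_mul, sum_g, sum_xg, Finset.sum_const, nsmul_eq_mul,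
    Finset.card_univ, Fintype.card_fin]
  have e2 : ∑ i, x i * ((m : ℝ) * g x i n) = m * ((n + 1) * h x (n + 1)) := by
    simp only [mul_left_comm (x _) (m : ℝ)]
    rw [← Finset.mul_sum, sum_xg]
  rw [e2]
  ring

lemma term_nonneg {m : ℕ} (x : Fin m → ℝ) (hx : ∀ i, 0 ≤ x i) (i j : Fin m) (n : ℕ) :
    0 ≤ (x i - x j) * (g x i n - g x j n) := by
  cases n with
  | zero => simp [g_zero]
  | succ n =>
    rw [g_sub, ← mul_assoc]
    exact mul_nonneg (mul_self_nonneg _) ((pow_nonneg (hx j) n).trans (f_ge x hx i j n).1)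

lemma step {m : ℕ} (x : Fin m → ℝ) (hx : ∀ i, 0 ≤ x i) (n : ℕ) :
    (n + m) * (∑ i, x i) * h x n ≤ (m : ℝ) * (n + 1) * h x (n + 1) := by
  have := cheb x n
  have h2 : 0 ≤ ∑ i, ∑ j, (x i - x j) * (g x i n - g x j n) :=
    Finset.sum_nonneg fun i _ => Finset.sum_nonneg fun j _ => term_nonneg x hx i j n
  linarith

lemma step_lt {m : ℕ} (x : Fin m → ℝ) (hx : ∀ i, 0 ≤ x i) (n : ℕ) (a b : Fin m)
    (hab : x a ≠ x b) :
    ((n + 1 : ℕ) + m) * (∑ i, x i) * h x (n + 1)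
      < (m : ℝ) * ((n + 1 : ℕ) + 1) * h x (n + 1 + 1) := by
  have := cheb x (n + 1)
  have h2 : 0 < ∑ i, ∑ j, (x i - x j) * (g x i (n + 1) - g x j (n + 1)) := by
    refine Finset.sum_pos' (fun i _ => Finset.sum_nonneg fun j _ => term_nonneg x hx i j _)
      ⟨a, Finset.mem_univ _, Finset.sum_pos' (fun j _ => term_nonneg x hx a j _)
        ⟨b, Finset.mem_univ _, ?_⟩⟩
    rw [g_sub, ← mul_assoc]
    refine mul_pos (mul_self_pos.2 (sub_ne_zero.2 hab)) ?_
    have hf := f_ge x hx a b n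
    rcases (hx a).lt_or_eq with ha | ha
    · exact (pow_pos ha n).trans_le hf.2
    · have hb : 0 < x b := lt_of_le_of_ne (hx b) (by rw [ha]; exact hab)
      exact (pow_pos hb n).trans_le hf.1
  linarith

lemma step_eq {m : ℕ} (x : Fin m → ℝ) (n : ℕ) (he : ∀ i j, x i = x j) :
    (n + m) * (∑ i, x i) * h x n = (m : ℝ) * (n + 1) * h x (n + 1) := by
  have := cheb x n
  have h2 : ∑ i, ∑ j, (x i - x j) * (g x i n - g x j n) = 0 :=
    Finset.sum_eq_zero fun i _ => Finset.sum_eq_zero fun j _ => by simp [he i j]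
  linarith

/-- right-hand side -/
noncomputable def c {m : ℕ} (x : Fin m → ℝ) (n : ℕ) : ℝ :=
  (Nat.choose (n + m - 1) (m - 1) : ℝ) * ((∑ i, x i) / m) ^ n

lemma c_step {m : ℕ} (hm : 1 ≤ m) (x : Fin m → ℝ) (n : ℕ) :
    (n + m) * (∑ i, x i) * c x n = (m : ℝ) * (n + 1) * c x (n + 1) := by
  obtain ⟨M, rfl⟩ : ∃ M, m = M + 1 := ⟨m - 1, by omega⟩
  have hc : ((n + M + 1 : ℕ) : ℝ) * (Nat.choose (n + M) M : ℝ)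
      = (Nat.choose (n + 1 + M) M : ℝ) * ((n + 1 : ℕ) : ℝ) := by
    have := Nat.add_one_mul_choose_eq (n + M) n
    rw [Nat.choose_symm_add (a := n) (b := M), show n + M + 1 = n + 1 + M by ring,
      Nat.choose_symm_add (a := n + 1) (b := M)] at this
    rw [show n + M + 1 = n + 1 + M by ring]
    exact_mod_cast this
  have hM : ((M + 1 : ℕ) : ℝ) ≠ 0 := by positivity
  simp only [c, show n + (M + 1) - 1 = n + M by omega, show M + 1 - 1 = M by omega,
    show n + 1 + (M + 1) - 1 = n + 1 + M by omega, pow_succ]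
  set S := ∑ i, x i
  set q := S / ((M + 1 : ℕ) : ℝ) with hq
  have hS : S = ((M + 1 : ℕ) : ℝ) * q := by rw [hq]; field_simp
  rw [hS]
  push_cast at hc ⊢
  linear_combination ((M : ℝ) + 1) * q * q ^ n * hc

lemma c_zero {m : ℕ} (x : Fin m → ℝ) : c x 0 = 1 := by simp [c]

lemma c_le {m : ℕ} (hm : 1 ≤ m) (x : Fin m → ℝ) (hx : ∀ i, 0 ≤ x i) (n : ℕ) :
    c x n ≤ h x n := by
  induction n with
  | zero => rw [c_zero, h_zero]
  | succ n ih =>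
    have hS : 0 ≤ ∑ i, x i := Finset.sum_nonneg fun i _ => hx i
    have hm' : (0 : ℝ) < m := by exact_mod_cast hm
    have h1 : (0 : ℝ) < (m : ℝ) * (n + 1) := by positivity
    refine le_of_mul_le_mul_left ?_ h1
    rw [← c_step hm]
    exact (mul_le_mul_of_nonneg_left ih (by positivity)).trans (step x hx n)

lemma c_lt {m : ℕ} (hm : 1 ≤ m) (x : Fin m → ℝ) (hx : ∀ i, 0 ≤ x i) (n : ℕ) (a b : Fin m)
    (hab : x a ≠ x b) : c x (n + 1 + 1) < h x (n + 1 + 1) := by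
  have hS : 0 ≤ ∑ i, x i := Finset.sum_nonneg fun i _ => hx i
  have hm' : (0 : ℝ) < m := by exact_mod_cast hm
  have h1 : (0 : ℝ) < (m : ℝ) * ((n + 1 : ℕ) + 1) := by positivity
  refine lt_of_mul_lt_mul_left ?_ h1.le
  rw [← c_step hm]
  exact (mul_le_mul_of_nonneg_left (c_le hm x hx (n + 1)) (by positivity)).trans_lt
    (step_lt x hx n a b hab)

lemma c_eq {m : ℕ} (hm : 1 ≤ m) (x : Fin m → ℝ) (he : ∀ i j, x i = x j) (n : ℕ) :
    h x n = c x n := by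
  induction n with
  | zero => rw [c_zero, h_zero]
  | succ n ih =>
    have hm' : (0 : ℝ) < m := by exact_mod_cast hm
    have h1 : (m : ℝ) * (n + 1) ≠ 0 := by positivity
    refine mul_left_cancel₀ h1 ?_
    rw [← c_step hm, ← step_eq x n he, ih]

end Haber


/-- Generalized Haber inequality (used in Lemma 3): for nonnegative reals `x_1, …, x_m`,
`∑_{i_1+⋯+i_m=n} ∏_k x_k^{i_k} ≥ C(n+m-1, m-1) ((x_1+⋯+x_m)/m)^n`, and for `m ≥ 2`,
`n ≥ 2`, equality holds iff all the `x_i` are equal. -/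
theorem stmt_12 (m n : ℕ) (hm : 1 ≤ m) (x : Fin m → ℝ) (hx : ∀ i, 0 ≤ x i) :
    ((Nat.choose (n + m - 1) (m - 1) : ℝ) * ((∑ i, x i) / m) ^ n
        ≤ ∑ k ∈ Finset.Nat.antidiagonalTuple m n, ∏ i, x i ^ k i) ∧
      (2 ≤ m → 2 ≤ n →
        ((∑ k ∈ Finset.Nat.antidiagonalTuple m n, ∏ i, x i ^ k i
            = (Nat.choose (n + m - 1) (m - 1) : ℝ) * ((∑ i, x i) / m) ^ n)
          ↔ ∀ i j, x i = x j)) := by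
  refine ⟨Haber.c_le hm x hx n, fun _ hn => ⟨fun heq => ?_, fun he => Haber.c_eq hm x he n⟩⟩
  by_contra hne
  push Not at hne
  obtain ⟨a, b, hab⟩ := hne
  obtain ⟨N, rfl⟩ : ∃ N, n = N + 1 + 1 := ⟨n - 2, by omega⟩
  exact (Haber.c_lt hm x hx N a b hab).ne' heq
end

section
/- Let a_k ≥ 0 and s_k ≥ 0 for k ∈ ℕ be arrival and service increments, define A(u,t) = ∑_{k=u}^{t−1} a_k and S(u,t) = ∑_{k=u}^{t−1} s_k for u ≤ t, and let D : ℕ → ℝ satisfy D(v) ≥ min_{0 ≤ τ ≤ v} (A(0,τ) + S(τ,v)) for all v. Fix t and w in ℕ. If A(τ,t) ≤ S(τ, t+w) for every 0 ≤ τ ≤ t, then A(0,t) ≤ D(t+w). -/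
/-- Deterministic delay bound of network calculus (equation (5)): with cumulative
arrivals `A(u,t) = ∑_{k=u}^{t-1} a_k`, service `S(u,t) = ∑_{k=u}^{t-1} s_k` and a
departure function with `D(v) ≥ min_{0≤τ≤v}(A(0,τ) + S(τ,v))`, if
`A(τ,t) ≤ S(τ,t+w)` for all `0 ≤ τ ≤ t` then `A(0,t) ≤ D(t+w)`. -/
theorem stmt_18 (a s : ℕ → ℝ) (ha : ∀ k, 0 ≤ a k) (hs : ∀ k, 0 ≤ s k)
    (D : ℕ → ℝ)
    (hD : ∀ v, (Finset.Icc 0 v).inf' (Finset.nonempty_Icc.mpr (Nat.zero_le v))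
        (fun τ => (∑ k ∈ Finset.range τ, a k) + ∑ k ∈ Finset.Ico τ v, s k) ≤ D v)
    (t w : ℕ)
    (h : ∀ τ ≤ t, (∑ k ∈ Finset.Ico τ t, a k) ≤ ∑ k ∈ Finset.Ico τ (t + w), s k) :
    (∑ k ∈ Finset.range t, a k) ≤ D (t + w) := by
  refine le_trans (Finset.le_inf' _ _ ?_) (hD (t + w))
  intro τ _
  rcases le_total τ t with hτ | hτ
  · have h1 := h τ hτ
    have h2 := Finset.sum_range_add_sum_Ico a hτ
    linarith
  · have h1 : (∑ k ∈ Finset.range t, a k) ≤ ∑ k ∈ Finset.range τ, a k :=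
      Finset.sum_le_sum_of_subset_of_nonneg (Finset.range_mono hτ) (fun k _ _ => ha k)
    have h2 : 0 ≤ ∑ k ∈ Finset.Ico τ (t + w), s k := Finset.sum_nonneg (fun k _ => hs k)
    linarith
end
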